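/- Let S ⊆ P^3(K) be a cubic surface defined over F_q, absolutely irreducible with only finitely many singular points, whose singular points are exactly four double points P_1, P_2, P_3, P_4 that are F_{q^4}-rational and form a single orbit under the Frobenius map x ↦ x^q. Then S is projectively equivalent to the surface of equation x_0x_1x_2 + x_3(β_0·x_0x_1 + β_1·x_1x_2 + β_2·x_0x_2) = 0 for some β_0, β_1, β_2 ∈ F_{q^4}: there exist an invertible 4×4 matrix over K and a nonzero scalar λ ∈ K such that composing the defining cubic form of S with the corresponding linear change of coordinates yields λ·(x_0x_1x_2 + x_3(β_0·x_0x_1 + β_1·x_1x_2 + β_2·x_0x_2)). -/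

import Mathlib

noncomputable section

open MvPolynomial

variable (Fq : Type) [Field Fq] [Fintype Fq]

/-- `Kbar Fq` is a fixed algebraic closure of the finite field `Fq`. -/
abbrev Kbar : Type _ := AlgebraicClosure Fq

/-- The projective space `P^3` over the algebraic closure of `Fq`. -/
abbrev P3 : Type _ := Projectivization (Kbar Fq) (Fin 4 → Kbar Fq)

variable {Fq}

/-- The zero locus in `P^3(K)` of a (homogeneous) polynomial. -/
def projZeros (F : MvPolynomial (Fin 4) (Kbar Fq)) : Set (P3 Fq) :=
  {p | eval p.rep F = 0}

/-- A point is singular for `F` if `F` and all four partial derivatives vanish there. -/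
def IsSingularAt (F : MvPolynomial (Fin 4) (Kbar Fq)) (p : P3 Fq) : Prop :=
  eval p.rep F = 0 ∧ ∀ i, eval p.rep (pderiv i F) = 0

/-- A projective point is `F_q`-rational (`q = Fintype.card Fq`) if it has a representative
all of whose coordinates lie in the subfield `F_q = {x | x ^ q = x}` of the closure. -/
def IsRatPoint (q : ℕ) (p : P3 Fq) : Prop :=
  ∃ (v : Fin 4 → Kbar Fq) (hv : v ≠ 0),
    Projectivization.mk (Kbar Fq) v hv = p ∧ ∀ i, v i ^ q = v i

/-- The projective line through two points (given via representatives). -/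
def lineThrough (p r : P3 Fq) : Set (P3 Fq) :=
  {s | ∃ (a b : Kbar Fq) (h : a • p.rep + b • r.rep ≠ 0),
      s = Projectivization.mk (Kbar Fq) (a • p.rep + b • r.rep) h}

/-- The restriction of `F` to the parametrized line `t ↦ v + t • w`, as a polynomial in
the parameter `t`. -/
def polyAlong (F : MvPolynomial (Fin 4) (Kbar Fq)) (v w : Fin 4 → Kbar Fq) :
    Polynomial (Kbar Fq) :=
  aeval (fun i => Polynomial.C (v i) + Polynomial.C (w i) * Polynomial.X) F

/-- `F` has multiplicity at least `m` at the point `v`. -/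
def multAtLeast (F : MvPolynomial (Fin 4) (Kbar Fq)) (v : Fin 4 → Kbar Fq) (m : ℕ) : Prop :=
  ∀ w : Fin 4 → Kbar Fq, ∀ k < m, (polyAlong F v w).coeff k = 0

/-- A double point: a singular point of multiplicity exactly two. -/
def IsDoublePt (F : MvPolynomial (Fin 4) (Kbar Fq)) (p : P3 Fq) : Prop :=
  IsSingularAt F p ∧ multAtLeast F p.rep 2 ∧ ¬ multAtLeast F p.rep 3

/-- The action of the `q`-power Frobenius on the points of `P^3(K)`. -/
def frobPt (p : P3 Fq) : P3 Fq :=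
  Projectivization.mk (Kbar Fq) (fun i => p.rep i ^ Fintype.card Fq) (by
    intro h
    apply p.rep_nonzero
    funext i
    have hi : p.rep i ^ Fintype.card Fq = 0 := congrFun h i
    have hcard : Fintype.card Fq ≠ 0 := by
      have : Nonempty Fq := ⟨0⟩
      exact Fintype.card_ne_zero
    exact (pow_eq_zero_iff hcard).mp hi)

namespace Cub

set_option linter.unusedSectionVars false

/-- Singularity of a form at a vector. -/
def Sing {K : Type*} [Field K] {σ : Type*} (F : MvPolynomial σ K) (v : σ → K) : Prop :=
  eval v F = 0 ∧ ∀ i, eval v (pderiv i F) = 0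

/-- Linear substitution. -/
abbrev sub {K : Type*} [Field K] {σ τ : Type*} [Fintype τ] (M : Matrix σ τ K) :
    MvPolynomial σ K →ₐ[K] MvPolynomial τ K :=
  aeval (fun i => ∑ j, C (M i j) * X j)

section
variable {K : Type*} [Field K] {σ τ : Type*} [Fintype σ] [Fintype τ] [DecidableEq σ] [DecidableEq τ]

theorem eval_smul_hom {F : MvPolynomial σ K} {n : ℕ} (hF : F.IsHomogeneous n) (a : K)
    (v : σ → K) : eval (a • v) F = a ^ n * eval v F := by
  rw [eval_eq', eval_eq', Finset.mul_sum]
  refine Finset.sum_congr rfl fun m hm => ?_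
  have h : m.degree = n := by
    by_contra h
    exact (mem_support_iff.mp hm) (hF.coeff_eq_zero h)
  simp only [Pi.smul_apply, smul_eq_mul, mul_pow, Finset.prod_mul_distrib]
  rw [Finset.prod_pow_eq_pow_sum, ← Finsupp.degree_eq_sum, h]
  ring

theorem hom_pderiv {F : MvPolynomial σ K} {n : ℕ} (hF : F.IsHomogeneous (n + 1)) (i : σ) :
    (pderiv i F).IsHomogeneous n := by
  have := hF.pderiv (i := i)
  simpa using this

theorem Sing.smul {F : MvPolynomial σ K} (hF : F.IsHomogeneous 3) {v : σ → K} (h : Sing F v)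
    (a : K) : Sing F (a • v) := by
  refine ⟨?_, fun i => ?_⟩
  · rw [eval_smul_hom hF, h.1, mul_zero]
  · rw [eval_smul_hom (hom_pderiv hF i), h.2 i, mul_zero]

theorem eval_sub (M : Matrix σ τ K) (F : MvPolynomial σ K) (u : τ → K) :
    eval u (sub M F) = eval (M.mulVec u) F := by
  rw [sub, ← coe_aeval_eq_eval, ← coe_aeval_eq_eval]
  change aeval u (aeval _ F) = aeval _ F
  rw [← AlgHom.comp_apply]
  congr 1
  ext i
  simp [Matrix.mulVec, dotProduct]

theorem pderiv_sub (M : Matrix σ τ K) (F : MvPolynomial σ K) (j : τ) :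
    pderiv j (sub M F) = ∑ i, C (M i j) * sub M (pderiv i F) := by
  induction F using MvPolynomial.induction_on with
  | C a => simp [sub]
  | add p q hp hq => simp only [map_add, hp, hq, mul_add, Finset.sum_add_distrib]
  | mul_X p k hp =>
    have h1 : pderiv j (sub M (X k)) = C (M k j) := by
      simp [sub, pderiv_X, Pi.single_apply]
    rw [map_mul, pderiv_mul, hp, h1]
    simp only [pderiv_mul, map_add, map_mul, mul_add, Finset.sum_add_distrib, Finset.sum_mul]
    congr 1
    · refine Finset.sum_congr rfl fun i _ => by ring
    · rw [Finset.sum_eq_single k]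
      · simp [mul_comm]
      · intro b _ hb
        rw [pderiv_X_of_ne hb.symm]; simp
      · simp

theorem Sing.sub {F : MvPolynomial σ K} {M : Matrix σ τ K} {u : τ → K}
    (h : Sing F (M.mulVec u)) : Sing (sub M F) u := by
  refine ⟨by rw [eval_sub, h.1], fun j => ?_⟩
  rw [pderiv_sub, map_sum]
  refine Finset.sum_eq_zero fun i _ => ?_
  rw [map_mul, eval_sub, h.2 i, mul_zero]

theorem hom_sub {F : MvPolynomial σ K} {n : ℕ} (hF : F.IsHomogeneous n) (M : Matrix σ τ K) :
    (Cub.sub M F).IsHomogeneous n := by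
  have := hF.aeval (fun i => ∑ j, C (M i j) * X j) (n := 1)
    (fun i => IsHomogeneous.sum _ _ _ fun j _ => isHomogeneous_C_mul_X _ _)
  simpa using this

theorem eval_single_hom {P : MvPolynomial σ K} {n : ℕ} (hP : P.IsHomogeneous n) (i : σ) :
    eval (Pi.single i 1) P = coeff (Finsupp.single i n) P := by
  rw [eval_eq', Finset.sum_eq_single (Finsupp.single i n)]
  · rw [Finset.prod_eq_one, mul_one]
    intro j _
    by_cases h : j = i
    · subst h; simp
    · simp [h]
  · intro m hm hne
    have hd : m.degree = n := by
      by_contra h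
      exact (mem_support_iff.mp hm) (hP.coeff_eq_zero h)
    have : ∃ j, j ≠ i ∧ m j ≠ 0 := by
      by_contra! hc
      apply hne
      have : m = Finsupp.single i (m i) := by
        ext j
        by_cases h : j = i
        · subst h; simp
        · simp [h, hc j h]
      rw [this] at hd ⊢
      rw [Finsupp.degree_single] at hd
      simp [hd]
    obtain ⟨j, hj, hmj⟩ := this
    rw [Finset.prod_eq_zero (Finset.mem_univ j), mul_zero]
    simp [hj, hmj]
  · intro h
    rw [notMem_support_iff.mp h, zero_mul]

theorem sing_coeff {F : MvPolynomial σ K} (hF : F.IsHomogeneous 3) {i : σ}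
    (h : Sing F (Pi.single i 1)) (m : σ →₀ ℕ) (hm : 2 ≤ m i) : coeff m F = 0 := by
  by_cases hd : m.degree = 3
  swap
  · exact hF.coeff_eq_zero hd
  obtain ⟨r, rfl⟩ : ∃ r, m = Finsupp.single i 2 + r :=
    exists_add_of_le (Finsupp.single_le_iff.mpr hm)
  rw [map_add, Finsupp.degree_single] at hd
  have hr : r.degree = 1 := by omega
  obtain ⟨j, rfl⟩ : ∃ j, r = Finsupp.single j 1 := by
    rw [Finsupp.degree_eq_sum] at hr
    obtain ⟨j, hj⟩ : ∃ j, r j ≠ 0 := by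
      by_contra! hc
      simp [hc] at hr
    refine ⟨j, ?_⟩
    rw [← Finset.add_sum_erase _ _ (Finset.mem_univ j)] at hr
    have h0 : ∑ x ∈ Finset.univ.erase j, r x = 0 := by omega
    rw [Finset.sum_eq_zero_iff] at h0
    ext k
    by_cases hk : k = j
    · subst hk; simp; omega
    · rw [h0 k (by simp [hk])]; simp [hk]
  by_cases hj : j = i
  · subst hj
    have := h.1
    rw [eval_single_hom hF] at this
    rw [← Finsupp.single_add]
    exact this
  · have := h.2 j
    rw [eval_single_hom (hom_pderiv hF j), coeff_pderiv] at this
    simpa [hj, Ne.symm hj] using this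

end

section
variable {K : Type*} [Field K]

theorem binary_quad {H : MvPolynomial (Fin 2) K} (hH : H.IsHomogeneous 2)
    (h0 : eval (Pi.single 0 1) H = 0) (h1 : eval (Pi.single 1 1) H = 0) {s t : K}
    (hs : s ≠ 0) (ht : t ≠ 0) (h : eval ![s, t] H = 0) : H = 0 := by
  rw [eval_single_hom hH] at h0 h1
  have key : ∀ m : Fin 2 →₀ ℕ, m ≠ Finsupp.single 0 1 + Finsupp.single 1 1 → coeff m H = 0 := by
    intro m hm
    by_cases hd : m.degree = 2
    swap
    · exact hH.coeff_eq_zero hd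
    rw [Finsupp.degree_eq_sum, Fin.sum_univ_two] at hd
    have : m 0 = 2 ∧ m 1 = 0 ∨ m 0 = 0 ∧ m 1 = 2 := by
      have : ¬ (m 0 = 1 ∧ m 1 = 1) := by
        rintro ⟨a, b⟩
        apply hm
        ext i
        fin_cases i <;> simp [a, b]
      omega
    rcases this with ⟨a, b⟩ | ⟨a, b⟩
    · rw [← h0]; congr 1; ext i; fin_cases i <;> simp [a, b]
    · rw [← h1]; congr 1; ext i; fin_cases i <;> simp [a, b]
  have hm : H = monomial (Finsupp.single 0 1 + Finsupp.single 1 1)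
      (coeff (Finsupp.single 0 1 + Finsupp.single 1 1) H) := by
    ext m
    rw [coeff_monomial]
    split_ifs with e
    · rw [e]
    · exact key m (Ne.symm e)
  rw [hm, eval_monomial, Finsupp.prod_fintype _ _ (by simp)] at h
  rw [hm]
  simp [Fin.prod_univ_two, hs, ht] at h
  simp [h]

theorem line_sing {F : MvPolynomial (Fin 4) K} (hF : F.IsHomogeneous 3) {u w : Fin 4 → K}
    {s t : K} (hs : s ≠ 0) (ht : t ≠ 0) (hu : Sing F u) (hw : Sing F w)
    (hv : Sing F (s • u + t • w)) (x y : K) : Sing F (x • u + y • w) := by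
  let M : Matrix (Fin 4) (Fin 2) K := Matrix.of fun i j => ![u i, w i] j
  have hM : ∀ x y, M.mulVec ![x, y] = x • u + y • w := by
    intro x y
    ext i
    simp [M, Matrix.mulVec, dotProduct, mul_comm]
  have e0 : (Pi.single 0 1 : Fin 2 → K) = ![1, 0] := by ext i; fin_cases i <;> simp
  have e1 : (Pi.single 1 1 : Fin 2 → K) = ![0, 1] := by ext i; fin_cases i <;> simp
  have hM0 : M.mulVec (Pi.single 0 1) = u := by rw [e0, hM]; simp
  have hM1 : M.mulVec (Pi.single 1 1) = w := by rw [e1, hM]; simp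
  refine ⟨?_, fun i => ?_⟩
  · have : Cub.sub M F = 0 := by
      ext m
      have g := hom_sub hF M
      by_cases hd : m.degree = 3
      swap
      · exact g.coeff_eq_zero hd
      rw [Finsupp.degree_eq_sum, Fin.sum_univ_two] at hd
      have : 2 ≤ m 0 ∨ 2 ≤ m 1 := by omega
      rcases this with h | h
      · exact sing_coeff g (Sing.sub (by rwa [hM0])) m h
      · exact sing_coeff g (Sing.sub (by rwa [hM1])) m h
    rw [← hM, ← eval_sub, this, map_zero]
  · have : Cub.sub M (pderiv i F) = 0 := by
      refine binary_quad (hom_sub (hom_pderiv hF i) M) ?_ ?_ hs ht ?_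
      · rw [eval_sub, hM0, hu.2]
      · rw [eval_sub, hM1, hw.2]
      · rw [eval_sub, hM, hv.2]
    rw [← hM, ← eval_sub, this, map_zero]

theorem X_dvd_of {G : MvPolynomial (Fin 4) K} (k : Fin 4)
    (h : ∀ m : Fin 4 →₀ ℕ, m k = 0 → coeff m G = 0) : X k ∣ G := by
  rw [X_dvd_iff_modMonomial_eq_zero]
  ext m
  by_cases hk : Finsupp.single k 1 ≤ m
  · rw [coeff_modMonomial_of_le _ hk, coeff_zero]
  · rw [coeff_modMonomial_of_not_le _ hk, coeff_zero]
    apply h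
    rw [Finsupp.single_le_iff] at hk
    omega

theorem sub_comp (M N : Matrix (Fin 4) (Fin 4) K) (F : MvPolynomial (Fin 4) K) :
    Cub.sub N (Cub.sub M F) = Cub.sub (M * N) F := by
  have : (Cub.sub N).comp (Cub.sub M) = Cub.sub (M * N) := by
    apply MvPolynomial.algHom_ext
    intro i
    simp only [AlgHom.comp_apply, Cub.sub, aeval_X, map_sum, map_mul, algHom_C, algebraMap_eq,
      Matrix.mul_apply, Finset.mul_sum, Finset.sum_mul]
    rw [Finset.sum_comm]
    simp only [mul_assoc]
  rw [← this]
  rfl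

theorem sub_one (F : MvPolynomial (Fin 4) K) : Cub.sub 1 F = F := by
  have : Cub.sub (1 : Matrix (Fin 4) (Fin 4) K) = AlgHom.id K _ := by
    ext1 i
    simp [Cub.sub, Matrix.one_apply, apply_ite]
  rw [this]; rfl

theorem irr_sub {F : MvPolynomial (Fin 4) K} (hF : Irreducible F)
    {M : Matrix (Fin 4) (Fin 4) K} (hM : IsUnit M.det) : Irreducible (Cub.sub M F) := by
  let e : MvPolynomial (Fin 4) K ≃ₐ[K] MvPolynomial (Fin 4) K :=
    AlgEquiv.ofAlgHom (Cub.sub M) (Cub.sub M⁻¹)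
      (by ext1 i; rw [AlgHom.comp_apply, sub_comp, Matrix.nonsing_inv_mul _ hM, sub_one]; rfl)
      (by ext1 i; rw [AlgHom.comp_apply, sub_comp, Matrix.mul_nonsing_inv _ hM, sub_one]; rfl)
  exact (MulEquiv.irreducible_iff e).mpr hF

theorem not_X_dvd {F : MvPolynomial (Fin 4) K} (hF : Irreducible F) (hh : F.IsHomogeneous 3)
    {M : Matrix (Fin 4) (Fin 4) K} (hM : IsUnit M.det) (k : Fin 4) (hd : X k ∣ Cub.sub M F) :
    False := by
  have hi := irr_sub hF hM
  have hg := hom_sub hh M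
  obtain ⟨Q, hQ⟩ := hd
  rw [hQ] at hi
  rcases hi.isUnit_or_isUnit rfl with h | h
  · have := h.map (eval (0 : Fin 4 → K))
    simp at this
  · obtain ⟨c, hc, rfl⟩ := MvPolynomial.isUnit_iff_eq_C_of_isReduced.mp h
    have := hg.coeff_eq_zero (d := Finsupp.single k 1) (by simp)
    rw [hQ, mul_comm, coeff_C_mul] at this
    simp at this
    exact hc.ne_zero this

/-- The exponent with 0 at k and 1 elsewhere. -/
def ex (k : Fin 4) : Fin 4 →₀ ℕ := Finsupp.equivFunOnFinite.symm fun i => if i = k then 0 else 1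

theorem ex_apply (k i : Fin 4) : ex k i = if i = k then 0 else 1 := rfl

theorem ex_inj : Function.Injective ex := by
  intro a b h
  have := congrArg (fun f => f a) h
  simp [ex_apply] at this
  exact this

theorem ex_eq {m : Fin 4 →₀ ℕ} (hd : m.degree = 3) (k : Fin 4) (hk : m k = 0)
    (h : ∀ i, i ≠ k → m i ≤ 1) : m = ex k := by
  rw [Finsupp.degree_eq_sum, Fin.sum_univ_four] at hd
  have h0 := h 0
  have h1 := h 1
  have h2 := h 2
  have h3 := h 3
  ext i
  rw [ex_apply]
  fin_cases k <;> fin_cases i <;> simp at hk h0 h1 h2 h3 ⊢ <;> omega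

theorem decomp0 {G : MvPolynomial (Fin 4) K} (hG : G.IsHomogeneous 3)
    (h : ∀ i : Fin 4, i ≠ 0 → Sing G (Pi.single i 1)) :
    ∃ c Q, G = monomial (ex 0) c + X 0 * Q := by
  refine ⟨coeff (ex 0) G, ?_⟩
  have : X 0 ∣ G - monomial (ex 0) (coeff (ex 0) G) := by
    refine X_dvd_of 0 fun m hm => ?_
    rw [coeff_sub, coeff_monomial]
    split_ifs with e
    · rw [e, sub_self]
    · rw [sub_zero]
      by_cases hd : m.degree = 3
      swap
      · exact hG.coeff_eq_zero hd
      by_contra hc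
      refine e (ex_eq hd 0 hm fun i hi => ?_).symm
      by_contra hlt
      exact hc (sing_coeff hG (h i hi) m (by omega))
  obtain ⟨Q, hQ⟩ := this
  exact ⟨Q, by rw [← hQ]; ring⟩

theorem decomp {G : MvPolynomial (Fin 4) K} (hG : G.IsHomogeneous 3)
    (h : ∀ i : Fin 4, Sing G (Pi.single i 1)) :
    G = ∑ k, monomial (ex k) (coeff (ex k) G) := by
  ext m
  rw [coeff_sum]
  simp only [coeff_monomial]
  by_cases hm : ∃ k, ex k = m
  · obtain ⟨k, rfl⟩ := hm
    rw [Finset.sum_eq_single k]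
    · simp
    · intro b _ hb
      rw [if_neg fun e => hb (ex_inj e)]
    · simp
  · push Not at hm
    rw [Finset.sum_eq_zero fun k _ => if_neg (hm k)]
    by_cases hd : m.degree = 3
    swap
    · exact hG.coeff_eq_zero hd
    by_contra hc
    have hle : ∀ i, m i ≤ 1 := fun i => by
      by_contra hlt
      exact hc (sing_coeff hG (h i) m (by omega))
    have : ∃ k, m k = 0 := by
      by_contra! hn
      rw [Finsupp.degree_eq_sum, Fin.sum_univ_four] at hd
      have := hn 0; have := hn 1; have := hn 2; have := hn 3
      omega
    obtain ⟨k, hk⟩ := this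
    exact hm k (ex_eq hd k hk fun i _ => hle i).symm

theorem mon_ex (k : Fin 4) (c : K) :
    monomial (ex k) c = C c * ∏ i, (X i : MvPolynomial (Fin 4) K) ^ (ex k i) := by
  rw [monomial_eq, Finsupp.prod_fintype _ _ (by simp)]

theorem plane {F : MvPolynomial (Fin 4) K} (hF : Irreducible F) (hh : F.IsHomogeneous 3)
    {a b c : Fin 4 → K} (hli : LinearIndependent K ![a, b, c])
    (ha : Sing F a) (hb : Sing F b) (hc : Sing F c) {x y z : K} (hx : x ≠ 0) (hy : y ≠ 0)
    (hz : z ≠ 0) (h : Sing F (x • a + y • b + z • c)) : False := by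
  obtain ⟨w, hw⟩ : ∃ w, w ∉ Submodule.span K (Set.range ![a, b, c]) := by
    by_contra! hall
    have htop : Submodule.span K (Set.range ![a, b, c]) = ⊤ := by
      ext v; exact iff_of_true (hall v) trivial
    have h1 := finrank_span_eq_card hli
    rw [htop, finrank_top] at h1
    simp at h1
  have hli' : LinearIndependent K (Fin.cons w ![a, b, c] : Fin 4 → Fin 4 → K) :=
    linearIndependent_finCons.mpr ⟨hli, hw⟩
  let u : Fin 4 → Fin 4 → K := ![w, a, b, c]
  let M : Matrix (Fin 4) (Fin 4) K := (Matrix.of u).transpose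
  have hM : IsUnit M.det := by
    rw [← Matrix.isUnit_iff_isUnit_det, ← Matrix.linearIndependent_cols_iff_isUnit]
    exact hli'
  have hcol : ∀ i, M.mulVec (Pi.single i 1) = u i := fun i => by
    rw [Matrix.mulVec_single_one]; rfl
  have hG := hom_sub hh M
  obtain ⟨d, Q, hQ⟩ := decomp0 hG (by
    intro i hi
    apply Sing.sub
    rw [hcol]
    fin_cases i
    · exact absurd rfl hi
    · exact ha
    · exact hb
    · exact hc)
  have he : eval ![0, x, y, z] (Cub.sub M F) = 0 := by
    rw [eval_sub]
    have : M.mulVec ![0, x, y, z] = x • a + y • b + z • c := by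
      ext i
      simp [M, u, Matrix.mulVec, dotProduct, Fin.sum_univ_four, mul_comm]
    rw [this, h.1]
  have hd : d = 0 := by
    rw [hQ, mon_ex] at he
    simpa [Fin.prod_univ_four, ex_apply, hx, hy, hz] using he
  rw [hd] at hQ
  refine not_X_dvd hF hh hM 0 ⟨Q, ?_⟩
  rw [hQ]; simp

end

section
variable {K : Type*} [Field K]

theorem tri {F : MvPolynomial (Fin 4) K} (hh : F.IsHomogeneous 3)
    (hno : ∀ u w : Fin 4 → K, LinearIndependent K ![u, w] → ¬ ∀ x y : K, Sing F (x • u + y • w))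
    {a b c : Fin 4 → K} (ha : Sing F a) (hb : Sing F b) (hc : Sing F c)
    (hab : LinearIndependent K ![a, b]) (hac : LinearIndependent K ![a, c])
    (hbc : LinearIndependent K ![b, c]) : LinearIndependent K ![c, a, b] := by
  refine linearIndependent_finCons.mpr ⟨hab, fun hmem => ?_⟩
  obtain ⟨g, hg⟩ := (Submodule.mem_span_range_iff_exists_fun K).mp hmem
  simp only [Fin.sum_univ_two, Matrix.cons_val_zero, Matrix.cons_val_one] at hg
  rw [LinearIndependent.pair_iff] at hac hbc
  have hs : g 0 ≠ 0 := by
    intro h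
    have := hbc (g 1) (-1) (by rw [← hg, h]; simp)
    simp at this
  have ht : g 1 ≠ 0 := by
    intro h
    have := hac (g 0) (-1) (by rw [← hg, h]; simp)
    simp at this
  exact hno a b hab (line_sing hh hs ht ha hb (by rw [hg]; exact hc))

theorem indep4 {F : MvPolynomial (Fin 4) K} (hF : Irreducible F) (hh : F.IsHomogeneous 3)
    (hno : ∀ u w : Fin 4 → K, LinearIndependent K ![u, w] → ¬ ∀ x y : K, Sing F (x • u + y • w))
    {a b c d : Fin 4 → K} (ha : Sing F a) (hb : Sing F b) (hc : Sing F c) (hd : Sing F d)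
    (hab : LinearIndependent K ![a, b]) (hac : LinearIndependent K ![a, c])
    (had : LinearIndependent K ![a, d])
    (hbc : LinearIndependent K ![b, c]) (hbd : LinearIndependent K ![b, d])
    (hcd : LinearIndependent K ![c, d]) : LinearIndependent K ![d, c, a, b] := by
  have h1 := tri hh hno ha hb hc hab hac hbc
  refine linearIndependent_finCons.mpr ⟨h1, fun hmem => ?_⟩
  obtain ⟨g, hg⟩ := (Submodule.mem_span_range_iff_exists_fun K).mp hmem
  have hg' : g 0 • c + g 1 • a + g 2 • b = d := by
    rw [← hg]; simp [Fin.sum_univ_three]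
  have n1 := (linearIndependent_finCons.mp (tri hh hno ha hb hd hab had hbd)).2
  have n2 := (linearIndependent_finCons.mp (tri hh hno ha hc hd hac had hcd)).2
  have n3 := (linearIndependent_finCons.mp (tri hh hno hb hc hd hbc hbd hcd)).2
  rw [Submodule.mem_span_range_iff_exists_fun] at n1 n2 n3
  refine plane hF hh h1 hc ha hb (x := g 0) (y := g 1) (z := g 2) ?_ ?_ ?_ (by rw [hg']; exact hd)
  · intro h
    exact n1 ⟨![g 1, g 2], by rw [← hg', h]; simp⟩
  · intro h
    exact n3 ⟨![g 2, g 0], by rw [← hg', h]; simp [add_comm]⟩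
  · intro h
    exact n2 ⟨![g 1, g 0], by rw [← hg', h]; simp [add_comm]⟩

theorem map_sub_fix (φ : K →+* K) (M : Matrix (Fin 4) (Fin 4) K) (hM : ∀ i j, φ (M i j) = M i j)
    (F : MvPolynomial (Fin 4) K) : map φ (Cub.sub M F) = Cub.sub M (map φ F) := by
  induction F using MvPolynomial.induction_on with
  | C a => simp only [Cub.sub, algHom_C, algebraMap_eq, map_C]
  | add p q hp hq => simp only [map_add, hp, hq]
  | mul_X p k hp =>
    rw [map_mul, map_mul, hp, map_mul, map_mul]
    congr 1
    simp only [Cub.sub, aeval_X, map_X, map_sum, map_mul, map_C, hM]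

theorem sum_ex (c : Fin 4 → K) : ∑ k, monomial (ex k) (c k) =
    C (c 0) * (X 1 * X 2 * X 3) + C (c 1) * (X 0 * X 2 * X 3) + C (c 2) * (X 0 * X 1 * X 3) +
      C (c 3) * (X 0 * X 1 * X 2) := by
  simp [mon_ex, Fin.sum_univ_four, Fin.prod_univ_four, ex_apply, Fin.ext_iff]

theorem final {F : MvPolynomial (Fin 4) K} (hF : Irreducible F) (hh : F.IsHomogeneous 3)
    (φ : K →+* K) (hφ : ∀ m, φ (coeff m F) = coeff m F)
    (u : Fin 4 → Fin 4 → K) (hu : LinearIndependent K u) (hs : ∀ i, Sing F (u i))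
    (hr : ∀ i j, φ (u i j) = u i j) :
    ∃ (M : Matrix (Fin 4) (Fin 4) K) (lam β0 β1 β2 : K),
      IsUnit M.det ∧ lam ≠ 0 ∧ φ β0 = β0 ∧ φ β1 = β1 ∧ φ β2 = β2 ∧
      aeval (fun i => ∑ j, C (M i j) * X j) F =
        C lam * (X 0 * X 1 * X 2 +
          X 3 * (C β0 * (X 0 * X 1) + C β1 * (X 1 * X 2) + C β2 * (X 0 * X 2))) := by
  let M : Matrix (Fin 4) (Fin 4) K := (Matrix.of u).transpose
  have hM : IsUnit M.det := by
    rw [← Matrix.isUnit_iff_isUnit_det, ← Matrix.linearIndependent_cols_iff_isUnit]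
    exact hu
  have hcol : ∀ i, M.mulVec (Pi.single i 1) = u i := fun i => by
    rw [Matrix.mulVec_single_one]; rfl
  have hG := hom_sub hh M
  have hdec := decomp hG (fun i => Sing.sub (by rw [hcol]; exact hs i))
  have hfix : ∀ m, φ (coeff m (Cub.sub M F)) = coeff m (Cub.sub M F) := by
    have hmF : map φ F = F := by ext m; rw [coeff_map, hφ]
    have hmG : map φ (Cub.sub M F) = Cub.sub M F := by
      rw [map_sub_fix φ M fun i j => hr j i, hmF]
    intro m
    conv_rhs => rw [← hmG]
    rw [coeff_map]
  have hlam : coeff (ex 3) (Cub.sub M F) ≠ 0 := by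
    intro h0
    apply not_X_dvd hF hh hM 3
    rw [hdec]
    refine Finset.dvd_sum fun k _ => ?_
    by_cases hk : k = 3
    · subst hk; rw [h0]; simp
    · rw [X_dvd_monomial]
      right
      rw [ex_apply, if_neg (Ne.symm hk)]
      exact one_ne_zero
  refine ⟨M, coeff (ex 3) (Cub.sub M F),
    coeff (ex 2) (Cub.sub M F) / coeff (ex 3) (Cub.sub M F),
    coeff (ex 0) (Cub.sub M F) / coeff (ex 3) (Cub.sub M F),
    coeff (ex 1) (Cub.sub M F) / coeff (ex 3) (Cub.sub M F), hM, hlam, ?_, ?_, ?_, ?_⟩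
  · rw [map_div₀, hfix, hfix]
  · rw [map_div₀, hfix, hfix]
  · rw [map_div₀, hfix, hfix]
  · change Cub.sub M F = _
    have hC : ∀ c : K, C (coeff (ex 3) (Cub.sub M F)) * C (c / coeff (ex 3) (Cub.sub M F)) =
        (C c : MvPolynomial (Fin 4) K) := fun c => by
      rw [← C_mul, mul_div_cancel₀ _ hlam]
    refine (hdec.trans (sum_ex fun k => coeff (ex k) (Cub.sub M F))).trans ?_
    rw [← hC (coeff (ex 0) (Cub.sub M F)), ← hC (coeff (ex 1) (Cub.sub M F)),
      ← hC (coeff (ex 2) (Cub.sub M F))]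
    ring

end

end Cub
/-- Let `S` be an absolutely irreducible cubic surface over `F_q` with
only finitely many singular points, whose singular points are exactly four double points
forming a single orbit under Frobenius and `F_{q^4}`-rational.  Then `S` is projectively
equivalent to the surface `x0·x1·x2 + x3·(β0·x0·x1 + β1·x1·x2 + β2·x0·x2) = 0` for some
`β0, β1, β2 ∈ F_{q^4}`. -/
theorem statement_14 (q : ℕ) (hq : q = Fintype.card Fq)
    (F : MvPolynomial (Fin 4) (Kbar Fq)) (hF0 : F ≠ 0) (hhom : F.IsHomogeneous 3)
    (hcoeff : ∀ m, coeff m F ^ q = coeff m F)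
    (hirr : Irreducible F)
    (hfin : {p : P3 Fq | IsSingularAt F p}.Finite)
    (P1 P2 P3' P4 : P3 Fq)
    (hdist : P1 ≠ P2 ∧ P1 ≠ P3' ∧ P1 ≠ P4 ∧ P2 ≠ P3' ∧ P2 ≠ P4 ∧ P3' ≠ P4)
    (hsing : {p : P3 Fq | IsSingularAt F p} = {P1, P2, P3', P4})
    (hdbl : IsDoublePt F P1 ∧ IsDoublePt F P2 ∧ IsDoublePt F P3' ∧ IsDoublePt F P4)
    (hrat : IsRatPoint (q ^ 4) P1 ∧ IsRatPoint (q ^ 4) P2 ∧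
      IsRatPoint (q ^ 4) P3' ∧ IsRatPoint (q ^ 4) P4)
    (horb : frobPt P1 = P2 ∧ frobPt P2 = P3' ∧ frobPt P3' = P4 ∧ frobPt P4 = P1) :
    ∃ (M : Matrix (Fin 4) (Fin 4) (Kbar Fq)) (lam β0 β1 β2 : Kbar Fq),
      IsUnit M.det ∧ lam ≠ 0 ∧
      β0 ^ q ^ 4 = β0 ∧ β1 ^ q ^ 4 = β1 ∧ β2 ^ q ^ 4 = β2 ∧
      aeval (fun i => ∑ j, C (M i j) * X j) F =
        C lam * (X 0 * X 1 * X 2 +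
          X 3 * (C β0 * (X 0 * X 1) + C β1 * (X 1 * X 2) + C β2 * (X 0 * X 2))) := by
  obtain ⟨⟨v1, z1, e1, r1⟩, ⟨v2, z2, e2, r2⟩, ⟨v3, z3, e3, r3⟩, ⟨v4, z4, e4, r4⟩⟩ := hrat
  obtain ⟨d12, d13, d14, d23, d24, d34⟩ := hdist
  have hpair : ∀ {P Q : P3 Fq} {v w : Fin 4 → Kbar Fq} (hv : v ≠ 0) (hw : w ≠ 0),
      Projectivization.mk (Kbar Fq) v hv = P → Projectivization.mk (Kbar Fq) w hw = Q →
      P ≠ Q → LinearIndependent (Kbar Fq) ![v, w] := by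
    rintro P Q v w hv hw rfl rfl hne
    rw [LinearIndependent.pair_iff' hv]
    intro a ha
    apply hne
    symm
    rw [Projectivization.mk_eq_mk_iff']
    exact ⟨a, ha⟩
  have hS : ∀ {P : P3 Fq} {v : Fin 4 → Kbar Fq} (hv : v ≠ 0),
      Projectivization.mk (Kbar Fq) v hv = P → IsSingularAt F P → Cub.Sing F v := by
    rintro P v hv rfl h
    obtain ⟨a, ha⟩ := Projectivization.exists_smul_eq_mk_rep (Kbar Fq) v hv
    have h' : Cub.Sing F (Projectivization.mk (Kbar Fq) v hv).rep := h
    rw [← ha] at h'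
    have h2 := h'.smul hhom ((a⁻¹ : (Kbar Fq)ˣ) : Kbar Fq)
    have : ((a⁻¹ : (Kbar Fq)ˣ) : Kbar Fq) • (a • v) = v := by
      change a⁻¹ • (a • v) = v
      simp
    rwa [this] at h2
  have hno : ∀ u w : Fin 4 → Kbar Fq, LinearIndependent (Kbar Fq) ![u, w] →
      ¬ ∀ x y : Kbar Fq, Cub.Sing F (x • u + y • w) := by
    intro u w hli hall
    rw [LinearIndependent.pair_iff] at hli
    have hnz : ∀ t : Kbar Fq, u + t • w ≠ 0 := fun t h => by
      have := hli 1 t (by rw [one_smul, h])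
      simp at this
    have : Infinite (Kbar Fq) := inferInstance
    refine Set.infinite_of_injective_forall_mem
      (f := fun t : Kbar Fq => Projectivization.mk (Kbar Fq) (u + t • w) (hnz t)) ?_ ?_ hfin
    · intro s t hst
      obtain ⟨a, ha⟩ := (Projectivization.mk_eq_mk_iff' _ _ _ _ _).mp hst
      have := hli (a - 1) (a * t - s) (by
        rw [sub_smul, sub_smul, mul_smul, one_smul]
        rw [smul_add] at ha
        linear_combination ha)
      have ha1 : a = 1 := sub_eq_zero.mp this.1
      have := this.2
      rw [ha1, one_mul] at this
      exact (sub_eq_zero.mp this).symm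
    · intro t
      obtain ⟨a, ha⟩ := Projectivization.exists_smul_eq_mk_rep (Kbar Fq) _ (hnz t)
      have h1 := (hall 1 t).smul hhom (a : Kbar Fq)
      rw [one_smul] at h1
      change Cub.Sing F (Projectivization.mk (Kbar Fq) (u + t • w) (hnz t)).rep
      rw [← ha]
      exact h1
  have hφ : ∀ x : Kbar Fq,
      ((FiniteField.frobeniusAlgHom Fq (Kbar Fq)) ^ 4 : Kbar Fq →ₐ[Fq] Kbar Fq).toRingHom x
        = x ^ q ^ 4 := by
    intro x
    change ((FiniteField.frobeniusAlgHom Fq (Kbar Fq)) ^ 4 : Kbar Fq →ₐ[Fq] Kbar Fq) x = _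
    rw [AlgHom.coe_pow, FiniteField.coe_frobeniusAlgHom, pow_iterate, hq]
  have s1 := hS z1 e1 hdbl.1.1
  have s2 := hS z2 e2 hdbl.2.1.1
  have s3 := hS z3 e3 hdbl.2.2.1.1
  have s4 := hS z4 e4 hdbl.2.2.2.1
  have hli := Cub.indep4 hirr hhom hno s1 s2 s3 s4 (hpair z1 z2 e1 e2 d12) (hpair z1 z3 e1 e3 d13)
    (hpair z1 z4 e1 e4 d14) (hpair z2 z3 e2 e3 d23) (hpair z2 z4 e2 e4 d24)
    (hpair z3 z4 e3 e4 d34)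
  have hfin := Cub.final hirr hhom
    ((FiniteField.frobeniusAlgHom Fq (Kbar Fq)) ^ 4 : Kbar Fq →ₐ[Fq] Kbar Fq).toRingHom
    (fun m => by
      rw [hφ]
      have h := hcoeff m
      rw [show q ^ 4 = q * q * q * q by ring, pow_mul, pow_mul, pow_mul, h, h, h, h])
    ![v4, v3, v1, v2] hli
    (fun i => by
      fin_cases i
      · exact s4
      · exact s3
      · exact s1
      · exact s2)
    (fun i j => by
      rw [hφ]
      fin_cases i
      · exact r4 j
      · exact r3 j
      · exact r1 j
      · exact r2 j)
  simpa only [hφ] using hfin
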